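/- (Finitary Completeness of Null Typing) Let M be a closed term of Λ⊕^cbv. Then for every k ∈ ℕ there exists a derivation Π ⊳ ⊢_w M : 𝟘 such that w ≥ etime_k(M). -/

import Mathlib

open scoped ENNReal

namespace CbV

/-! ### Terms of the probabilistic call-by-value λ-calculus `Λ⊕^cbv` -/

mutual
inductive Val : Type
  | var : ℕ → Val
  | lam : ℕ → Tm → Val
inductive Tm : Type
  | val : Val → Tm
  | app : Val → Val → Tm
  | choice : Tm → Tm → Tm
  | letin : ℕ → Tm → Tm → Tm
end

-- Substitution of a value for a variable.
mutual
def substV : Val → ℕ → Val → Val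
  | .var y, x, V => if y = x then V else .var y
  | .lam y M, x, V => if y = x then .lam y M else .lam y (substT M x V)
def substT : Tm → ℕ → Val → Tm
  | .val W, x, V => .val (substV W x V)
  | .app W U, x, V => .app (substV W x V) (substV U x V)
  | .choice M N, x, V => .choice (substT M x V) (substT N x V)
  | .letin y N M, x, V => .letin y (substT N x V) (if y = x then M else substT M x V)
end

mutual
def fvV : Val → Finset ℕ
  | .var x => {x}
  | .lam x M => fvT M \ {x}
def fvT : Tm → Finset ℕ
  | .val V => fvV V
  | .app V W => fvV V ∪ fvV W
  | .choice M N => fvT M ∪ fvT N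
  | .letin x N M => fvT N ∪ (fvT M \ {x})
end

def Tm.Closed (M : Tm) : Prop := fvT M = ∅
def Val.Closed (V : Val) : Prop := fvV V = ∅

def Tm.isVal : Tm → Bool
  | .val _ => true
  | _ => false

/-! ### Multidistributions and the operational semantics -/

/-- Multidistributions over terms, represented as finite multisets of scaled terms. -/
abbrev MDist := Multiset (ℚ × Tm)

def scaleM (q : ℚ) (m : MDist) : MDist := m.map fun p => (q * p.1, p.2)

/-- One-step reduction from terms to multidistributions. -/
inductive Step : Tm → MDist → Prop
  | beta (x : ℕ) (M : Tm) (V : Val) :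
      Step (.app (.lam x M) V) {(1, substT M x V)}
  | letval (x : ℕ) (V : Val) (M : Tm) :
      Step (.letin x (.val V) M) {(1, substT M x V)}
  | choice (M N : Tm) : Step (.choice M N) {(1/2, M), (1/2, N)}
  | letstep {N : Tm} {m : MDist} (x : ℕ) (M : Tm) :
      Step N m → Step (.letin x N M) (m.map fun p => (p.1, Tm.letin x p.2 M))

/-- Lifting of one-step reduction to multidistributions. -/
inductive Lift : MDist → MDist → Prop
  | value (V : Val) : Lift {(1, Tm.val V)} {(1, Tm.val V)}
  | single {M : Tm} {m : MDist} : Step M m → Lift {(1, M)} m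
  | multi (s : Multiset (ℚ × Tm × MDist)) :
      (∀ x ∈ s, Lift {(1, x.2.1)} x.2.2) →
      Lift (s.map fun x => (x.1, x.2.1)) ((s.map fun x => scaleM x.1 x.2.2).sum)

/-- Functional presentation of one-step reduction (values, and stuck open
terms, are kept unchanged); it agrees with `Step` on closed non-value terms. -/
def stepF : Tm → MDist
  | .val V => {(1, .val V)}
  | .app (.lam x M) W => {(1, substT M x W)}
  | .app (.var y) W => {(1, .app (.var y) W)}
  | .choice M N => {(1/2, M), (1/2, N)}
  | .letin x (.val V) M => {(1, substT M x V)}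
  | .letin x N M => (stepF N).map fun p => (p.1, Tm.letin x p.2 M)

def mstepF (m : MDist) : MDist := (m.map fun p => scaleM p.1 (stepF p.2)).sum

/-- The unique reduction sequence `[M] = 𝔪₀ ⇛ 𝔪₁ ⇛ …` of a closed term. -/
def traj (M : Tm) (k : ℕ) : MDist := mstepF^[k] {(1, M)}

/-- `‖𝔪‖𝒱`: the probability that `𝔪` is a value. -/
def normV (m : MDist) : ℚ := ((m.filter fun p => p.2.isVal = true).map Prod.fst).sum

/-- `eval_k(M)`: the probability that `M` terminates within `k` steps. -/
def evalP (k : ℕ) (M : Tm) : ℚ := normV (traj M k)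

/-- `ProbTerm(M) = sup_k eval_k(M)`. -/
noncomputable def ProbTerm (M : Tm) : ℝ := ⨆ k : ℕ, ((evalP k M : ℚ) : ℝ)

/-- `etime_n(M) = Σ_{k<n} (1 - eval_k(M))`. -/
def etime (n : ℕ) (M : Tm) : ℚ := ∑ k ∈ Finset.range n, (1 - evalP k M)

/-- `ETime(M) = Σ_{k≥0} (1 - eval_k(M)) ∈ [0,∞]`, the expected runtime. -/
noncomputable def ETime (M : Tm) : ℝ≥0∞ :=
  ∑' k : ℕ, ENNReal.ofReal ((1 : ℝ) - ((evalP k M : ℚ) : ℝ))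

/-! ### Non-idempotent monadic intersection types -/

/-- Arrow types `𝖠 ::= 𝒜 → 𝔞`, where `𝒜` is an intersection type
(a finite multiset of scaled arrow types, represented as a list) and `𝔞`
is a type distribution (a multidistribution of intersection types,
represented as a list). -/
inductive ATy : Type
  | arr : List (ℚ × ATy) → List (ℚ × List (ℚ × ATy)) → ATy

/-- Intersection types. -/
abbrev ITy := List (ℚ × ATy)
/-- Type distributions. -/
abbrev DTy := List (ℚ × ITy)

/-- A type of any of the three kinds. -/
inductive Ty : Type
  | arrow : ATy → Ty
  | inter : ITy → Ty
  | dist : DTy → Ty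

/-- Typing contexts. -/
abbrev Ctx := ℕ → ITy

def emptyCtx : Ctx := fun _ => []

def scaleL {α : Type} (q : ℚ) (l : List (ℚ × α)) : List (ℚ × α) :=
  l.map fun p => (q * p.1, p.2)

def ctxUnion (Γ Δ : Ctx) : Ctx := fun x => Γ x ++ Δ x

/-- A type distribution is tight if every intersection type in it is empty. -/
def Tight (a : DTy) : Prop := ∀ p ∈ a, p.2 = ([] : ITy)

/-- `‖𝔞‖`: the sum of the probabilities occurring in a type distribution. -/
def normD (a : DTy) : ℚ := (a.map Prod.fst).sum

/-- Typing derivations `Π ⊳ Γ ⊢_w M : σ`. -/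
inductive Deriv : Ctx → ℚ → Tm → Ty → Type
  | var (x : ℕ) (A : ITy) :
      Deriv (Function.update emptyCtx x A) 0 (.val (.var x)) (.inter A)
  | zero (M : Tm) : Deriv emptyCtx 0 M (.dist [])
  | lam {Γ : Ctx} {w : ℚ} {M : Tm} (x : ℕ) (b : DTy) :
      Deriv Γ w M (.dist b) →
      Deriv (Function.update Γ x []) (w + 1) (.val (.lam x M)) (.arrow (.arr (Γ x) b))
  | app {Γ Δ : Ctx} {w v : ℚ} {V W : Val} {A : ITy} {b : DTy} :
      Deriv Γ w (.val V) (.inter [(1, .arr A b)]) →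
      Deriv Δ v (.val W) (.inter A) →
      Deriv (ctxUnion Γ Δ) (w + v) (.app V W) (.dist b)
  | choice {Γ Δ : Ctx} {w v : ℚ} {M N : Tm} {a b : DTy} :
      Deriv Γ w M (.dist a) → Deriv Δ v N (.dist b) →
      Deriv (ctxUnion (fun y => scaleL (1/2) (Γ y)) (fun y => scaleL (1/2) (Δ y)))
        (w / 2 + v / 2 + 1) (.choice M N)
        (.dist (scaleL (1/2) a ++ scaleL (1/2) b))
  | letin {Γ : Ctx} {v : ℚ} (x : ℕ) {N M : Tm}
      (K : List (ℚ × ITy × Ctx × ℚ × DTy)) :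
      (∀ k ∈ K, k.2.2.1 x = []) →
      ((i : Fin K.length) →
        Deriv (Function.update (K.get i).2.2.1 x (K.get i).2.1)
          (K.get i).2.2.2.1 M (.dist (K.get i).2.2.2.2)) →
      Deriv Γ v N (.dist (K.map fun k => (k.1, k.2.1))) →
      Deriv (ctxUnion Γ (fun y => (K.map fun k => scaleL k.1 (k.2.2.1 y)).flatten))
        ((K.map fun k => k.1 * k.2.2.2.1).sum + v + 1)
        (.letin x N M)
        (.dist (K.map fun k => scaleL k.1 k.2.2.2.2).flatten)
  | tval {Γ : Ctx} {w : ℚ} {V : Val} {A : ITy} :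
      Deriv Γ w (.val V) (.inter A) → Deriv Γ w (.val V) (.dist [(1, A)])
  | bang {V : Val} (I : List (ℚ × Ctx × ℚ × ATy)) :
      (∀ k ∈ I, 0 < k.1 ∧ k.1 ≤ 1) →
      ((i : Fin I.length) →
        Deriv (I.get i).2.1 (I.get i).2.2.1 (.val V) (.arrow (I.get i).2.2.2)) →
      Deriv (fun y => (I.map fun k => scaleL k.1 (k.2.1 y)).flatten)
        ((I.map fun k => k.1 * k.2.2.1).sum) (.val V)
        (.inter (I.map fun k => (k.1, k.2.2.2)))

/-- Size of a derivation: the number of rules, excluding `!` and `Val`. -/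
def Deriv.size : ∀ {Γ : Ctx} {w : ℚ} {M : Tm} {τ : Ty}, Deriv Γ w M τ → ℕ
  | _, _, _, _, .var _ _ => 1
  | _, _, _, _, .zero _ => 1
  | _, _, _, _, .lam _ _ d => d.size + 1
  | _, _, _, _, .app d e => d.size + e.size + 1
  | _, _, _, _, .choice d e => d.size + e.size + 1
  | _, _, _, _, .letin _ _ _ f d => d.size + (List.ofFn fun i => (f i).size).sum + 1
  | _, _, _, _, .tval d => d.size
  | _, _, _, _, .bang _ _ f => (List.ofFn fun i => (f i).size).sum


/-! ### A convenient, structurally recursive presentation of (a part of) the type system -/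

def scaleC (q : ℚ) (Γ : Ctx) : Ctx := fun y => scaleL q (Γ y)

inductive Bang (P : Ctx → ℚ → ATy → Prop) : Ctx → ℚ → ITy → Prop
  | nil : Bang P emptyCtx 0 []
  | cons {Γ Δ : Ctx} {u w q : ℚ} {a : ATy} {A : ITy} :
      0 < q → q ≤ 1 → P Γ u a → Bang P Δ w A →
      Bang P (ctxUnion (scaleC q Γ) Δ) (q * u + w) ((q, a) :: A)

inductive LetK (x : ℕ) (P : Ctx → ℚ → DTy → Prop) : Ctx → ℚ → DTy → DTy → Prop
  | nil : LetK x P emptyCtx 0 [] []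
  | cons {Γ Δ : Ctx} {u w p : ℚ} {A : ITy} {b c l : DTy} :
      0 < p → p ≤ 1 → Γ x = [] → P (Function.update Γ x A) u b → LetK x P Δ w l c →
      LetK x P (ctxUnion (scaleC p Γ) Δ) (p * u + w) ((p, A) :: l) (scaleL p b ++ c)

def LamP (x : ℕ) (P : Ctx → ℚ → DTy → Prop) : Ctx → ℚ → ATy → Prop := fun Γ w a =>
  ∃ Γ' w' b, P Γ' w' b ∧ Γ = Function.update Γ' x [] ∧ w = w' + 1 ∧ a = .arr (Γ' x) b

def ZeroP : Ctx → ℚ → DTy → Prop := fun Γ w b => Γ = emptyCtx ∧ w = 0 ∧ b = []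

mutual
def VI : Val → Ctx → ℚ → ITy → Prop
  | .var x => fun Γ w A => Γ = Function.update emptyCtx x A ∧ w = 0
  | .lam x M => Bang (LamP x (TD M))
def TD : Tm → Ctx → ℚ → DTy → Prop
  | .val V => fun Γ w b => ZeroP Γ w b ∨ ∃ A, b = [(1, A)] ∧ VI V Γ w A
  | .app V W => fun Γ w b => ZeroP Γ w b ∨ ∃ Γ₁ Γ₂ w₁ w₂ A, VI V Γ₁ w₁ [(1, .arr A b)] ∧
      VI W Γ₂ w₂ A ∧ Γ = ctxUnion Γ₁ Γ₂ ∧ w = w₁ + w₂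
  | .choice M N => fun Γ w b => ZeroP Γ w b ∨ ∃ Γ₁ Γ₂ w₁ w₂ b₁ b₂, TD M Γ₁ w₁ b₁ ∧
      TD N Γ₂ w₂ b₂ ∧ Γ = ctxUnion (scaleC (1/2) Γ₁) (scaleC (1/2) Γ₂) ∧
      w = w₁ / 2 + w₂ / 2 + 1 ∧ b = scaleL (1/2) b₁ ++ scaleL (1/2) b₂
  | .letin x N M => fun Γ w b => ZeroP Γ w b ∨ ∃ Γ₁ Γ₂ v u l, TD N Γ₁ v l ∧
      LetK x (TD M) Γ₂ u l b ∧ Γ = ctxUnion Γ₁ Γ₂ ∧ w = u + v + 1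
end

theorem TD_zero (M : Tm) : TD M emptyCtx 0 [] := by
  cases M <;> (rw [TD]; exact Or.inl ⟨rfl, rfl, rfl⟩)

/-! #### Contexts -/

@[simp] theorem scaleL_nil {α : Type} (q : ℚ) : scaleL q ([] : List (ℚ × α)) = [] := rfl

theorem scaleL_one {α : Type} (l : List (ℚ × α)) : scaleL 1 l = l := by
  simp [scaleL]

theorem scaleL_append {α : Type} (q : ℚ) (l m : List (ℚ × α)) :
    scaleL q (l ++ m) = scaleL q l ++ scaleL q m := by
  simp [scaleL]

theorem scaleL_mul {α : Type} (q r : ℚ) (l : List (ℚ × α)) :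
    scaleL q (scaleL r l) = scaleL (q * r) l := by
  simp [scaleL, mul_assoc]

@[simp] theorem ctxUnion_empty (Γ : Ctx) : ctxUnion Γ emptyCtx = Γ := by
  funext y; simp [ctxUnion, emptyCtx]

@[simp] theorem empty_ctxUnion (Γ : Ctx) : ctxUnion emptyCtx Γ = Γ := by
  funext y; simp [ctxUnion, emptyCtx]

@[simp] theorem scaleC_empty (q : ℚ) : scaleC q emptyCtx = emptyCtx := by
  funext y; simp [scaleC, emptyCtx]

theorem scaleC_one (Γ : Ctx) : scaleC 1 Γ = Γ := by
  funext y; simp [scaleC, scaleL_one]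

theorem scaleC_mul (q r : ℚ) (Γ : Ctx) : scaleC q (scaleC r Γ) = scaleC (q * r) Γ := by
  funext y; simp [scaleC, scaleL_mul]

theorem scaleC_union (q : ℚ) (Γ Δ : Ctx) :
    scaleC q (ctxUnion Γ Δ) = ctxUnion (scaleC q Γ) (scaleC q Δ) := by
  funext y; simp [scaleC, ctxUnion, scaleL_append]

theorem ctxUnion_assoc (Γ Δ Θ : Ctx) :
    ctxUnion (ctxUnion Γ Δ) Θ = ctxUnion Γ (ctxUnion Δ Θ) := by
  funext y; simp [ctxUnion]

theorem update_union (Γ Δ : Ctx) (x : ℕ) (A B : ITy) :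
    Function.update (ctxUnion Γ Δ) x (A ++ B)
      = ctxUnion (Function.update Γ x A) (Function.update Δ x B) := by
  funext y
  by_cases h : y = x
  · subst h; simp [ctxUnion]
  · simp [ctxUnion, h]

theorem update_scale (Γ : Ctx) (x : ℕ) (q : ℚ) (A : ITy) :
    Function.update (scaleC q Γ) x (scaleL q A) = scaleC q (Function.update Γ x A) := by
  funext y
  by_cases h : y = x
  · subst h; simp [scaleC]
  · simp [scaleC, h]

theorem update_nil {Γ : Ctx} {x : ℕ} (h : Γ x = []) : Function.update Γ x [] = Γ := by
  rw [← h]; simp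

theorem union_eq_empty {Γ Δ : Ctx} (h : ctxUnion Γ Δ = emptyCtx) :
    Γ = emptyCtx ∧ Δ = emptyCtx := by
  constructor <;> funext y <;> have := congrFun h y <;> simp [ctxUnion, emptyCtx] at this ⊢
  · exact this.1
  · exact this.2

/-! #### Soundness of the presentation -/

theorem Bang.list {P : Ctx → ℚ → ATy → Prop} {Γ : Ctx} {w : ℚ} {A : ITy} (h : Bang P Γ w A) :
    ∃ I : List (ℚ × Ctx × ℚ × ATy), (∀ k ∈ I, 0 < k.1 ∧ k.1 ≤ 1) ∧
      (∀ k ∈ I, P k.2.1 k.2.2.1 k.2.2.2) ∧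
      Γ = (fun y => (I.map fun k => scaleL k.1 (k.2.1 y)).flatten) ∧
      w = (I.map fun k => k.1 * k.2.2.1).sum ∧ A = I.map fun k => (k.1, k.2.2.2) := by
  induction h with
  | nil => exact ⟨[], by simp, by simp, by funext y; simp [emptyCtx], by simp, by simp⟩
  | @cons Γ Δ u w q a A h0 h1 hP _ ih =>
    obtain ⟨I, i1, i2, i3, i4, i5⟩ := ih
    refine ⟨(q, Γ, u, a) :: I, ?_, ?_, ?_, ?_, ?_⟩
    · simp only [List.mem_cons, forall_eq_or_imp]; exact ⟨⟨h0, h1⟩, i1⟩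
    · simp only [List.mem_cons, forall_eq_or_imp]; exact ⟨hP, i2⟩
    · funext y; simp [i3, ctxUnion, scaleC]
    · simp [i4]
    · simp [i5]

theorem LetK.list {x : ℕ} {P : Ctx → ℚ → DTy → Prop} {Γ : Ctx} {w : ℚ} {l b : DTy}
    (h : LetK x P Γ w l b) :
    ∃ K : List (ℚ × ITy × Ctx × ℚ × DTy), (∀ k ∈ K, k.2.2.1 x = []) ∧
      (∀ k ∈ K, P (Function.update k.2.2.1 x k.2.1) k.2.2.2.1 k.2.2.2.2) ∧
      Γ = (fun y => (K.map fun k => scaleL k.1 (k.2.2.1 y)).flatten) ∧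
      w = (K.map fun k => k.1 * k.2.2.2.1).sum ∧ l = (K.map fun k => (k.1, k.2.1)) ∧
      b = (K.map fun k => scaleL k.1 k.2.2.2.2).flatten := by
  induction h with
  | nil => exact ⟨[], by simp, by simp, by funext y; simp [emptyCtx], by simp, by simp, by simp⟩
  | @cons Γ Δ u w p A b c l h0 h1 hx hP _ ih =>
    obtain ⟨I, i1, i2, i3, i4, i5, i6⟩ := ih
    refine ⟨(p, A, Γ, u, b) :: I, ?_, ?_, ?_, ?_, ?_, ?_⟩
    · simp only [List.mem_cons, forall_eq_or_imp]; exact ⟨hx, i1⟩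
    · simp only [List.mem_cons, forall_eq_or_imp]; exact ⟨hP, i2⟩
    · funext y; simp [i3, ctxUnion, scaleC]
    · simp [i4]
    · simp [i5]
    · simp [i6]

mutual
theorem VI_sound : ∀ (V : Val) {Γ : Ctx} {w : ℚ} {A : ITy}, VI V Γ w A →
    Nonempty (Deriv Γ w (.val V) (.inter A))
  | .var x, Γ, w, A, h => by
    rw [VI] at h
    obtain ⟨rfl, rfl⟩ := h
    exact ⟨.var x A⟩
  | .lam x M, Γ, w, A, h => by
    rw [VI] at h
    obtain ⟨I, i1, i2, rfl, rfl, rfl⟩ := h.list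
    have key : ∀ k ∈ I, Nonempty (Deriv k.2.1 k.2.2.1 (.val (.lam x M)) (.arrow k.2.2.2)) := by
      intro k hk
      obtain ⟨Γ', w', b, hT, e1, e2, e3⟩ := i2 k hk
      rw [e1, e2, e3]
      obtain ⟨d⟩ := TD_sound M hT
      exact ⟨.lam x b d⟩
    exact ⟨.bang I i1 fun i => Classical.choice (key _ (List.get_mem I i))⟩
theorem TD_sound : ∀ (M : Tm) {Γ : Ctx} {w : ℚ} {b : DTy}, TD M Γ w b →
    Nonempty (Deriv Γ w M (.dist b))
  | .val V, Γ, w, b, h => by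
    rw [TD] at h
    rcases h with ⟨rfl, rfl, rfl⟩ | ⟨A, rfl, h⟩
    · exact ⟨.zero _⟩
    · obtain ⟨d⟩ := VI_sound V h
      exact ⟨.tval d⟩
  | .app V W, Γ, w, b, h => by
    rw [TD] at h
    rcases h with ⟨rfl, rfl, rfl⟩ | ⟨Γ₁, Γ₂, w₁, w₂, A, h1, h2, rfl, rfl⟩
    · exact ⟨.zero _⟩
    · obtain ⟨d⟩ := VI_sound V h1
      obtain ⟨e⟩ := VI_sound W h2
      exact ⟨.app d e⟩
  | .choice M N, Γ, w, b, h => by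
    rw [TD] at h
    rcases h with ⟨rfl, rfl, rfl⟩ | ⟨Γ₁, Γ₂, w₁, w₂, b₁, b₂, h1, h2, rfl, rfl, rfl⟩
    · exact ⟨.zero _⟩
    · obtain ⟨d⟩ := TD_sound M h1
      obtain ⟨e⟩ := TD_sound N h2
      exact ⟨.choice d e⟩
  | .letin x N M, Γ, w, b, h => by
    rw [TD] at h
    rcases h with ⟨rfl, rfl, rfl⟩ | ⟨Γ₁, Γ₂, v, u, l, h1, h2, rfl, rfl⟩
    · exact ⟨.zero _⟩
    · obtain ⟨K, k1, k2, rfl, rfl, rfl, rfl⟩ := h2.list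
      obtain ⟨d⟩ := TD_sound N h1
      have key : ∀ k ∈ K, Nonempty (Deriv (Function.update k.2.2.1 x k.2.1)
          k.2.2.2.1 M (.dist k.2.2.2.2)) := fun k hk => TD_sound M (k2 k hk)
      exact ⟨.letin x K k1 (fun i => Classical.choice (key _ (List.get_mem K i))) d⟩
end

/-! #### Supports -/

theorem Bang.supp {P : Ctx → ℚ → ATy → Prop} {Γ : Ctx} {w : ℚ} {A : ITy} (h : Bang P Γ w A)
    {y : ℕ} (hP : ∀ Γ w a, P Γ w a → Γ y = []) : Γ y = [] := by
  induction h with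
  | nil => rfl
  | cons _ _ h _ ih => simp [ctxUnion, scaleC, ih, hP _ _ _ h]

theorem LetK.supp {x : ℕ} {P : Ctx → ℚ → DTy → Prop} {Γ : Ctx} {w : ℚ} {l b : DTy}
    (h : LetK x P Γ w l b) {y : ℕ} (hP : y ≠ x → ∀ Γ w a, P Γ w a → Γ y = []) : Γ y = [] := by
  induction h with
  | nil => rfl
  | @cons Γ Δ u w p A b c l _ _ hx h _ ih =>
    have : Γ y = [] := by
      by_cases hy : y = x
      · rw [hy, hx]
      · have := hP hy _ _ _ h
        simpa [hy] using this
    simp [ctxUnion, scaleC, ih, this]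

mutual
theorem VI_supp : ∀ (V : Val) {Γ : Ctx} {w : ℚ} {A : ITy}, VI V Γ w A →
    ∀ y, y ∉ fvV V → Γ y = []
  | .var x, Γ, w, A, h, y, hy => by
    rw [VI] at h
    obtain ⟨rfl, rfl⟩ := h
    simp [fvV] at hy
    simp [hy, emptyCtx]
  | .lam x M, Γ, w, A, h, y, hy => by
    rw [VI] at h
    refine h.supp ?_
    rintro _ _ _ ⟨Γ', w', b, hT, rfl, -, -⟩
    by_cases hxy : y = x
    · subst hxy; simp
    · simp only [ne_eq, hxy, not_false_eq_true, Function.update_of_ne]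
      exact TD_supp M hT y (by simpa [fvV, hxy] using hy)
theorem TD_supp : ∀ (M : Tm) {Γ : Ctx} {w : ℚ} {b : DTy}, TD M Γ w b →
    ∀ y, y ∉ fvT M → Γ y = []
  | .val V, Γ, w, b, h, y, hy => by
    rw [TD] at h
    rcases h with ⟨rfl, rfl, rfl⟩ | ⟨A, rfl, h⟩
    · rfl
    · exact VI_supp V h y (by simpa [fvT] using hy)
  | .app V W, Γ, w, b, h, y, hy => by
    rw [TD] at h
    simp [fvT] at hy
    rcases h with ⟨rfl, rfl, rfl⟩ | ⟨Γ₁, Γ₂, w₁, w₂, A, h1, h2, rfl, rfl⟩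
    · rfl
    · simp [ctxUnion, VI_supp V h1 y hy.1, VI_supp W h2 y hy.2]
  | .choice M N, Γ, w, b, h, y, hy => by
    rw [TD] at h
    simp [fvT] at hy
    rcases h with ⟨rfl, rfl, rfl⟩ | ⟨Γ₁, Γ₂, w₁, w₂, b₁, b₂, h1, h2, rfl, rfl, rfl⟩
    · rfl
    · simp [ctxUnion, scaleC, TD_supp M h1 y hy.1, TD_supp N h2 y hy.2]
  | .letin x N M, Γ, w, b, h, y, hy => by
    rw [TD] at h
    simp [fvT] at hy
    rcases h with ⟨rfl, rfl, rfl⟩ | ⟨Γ₁, Γ₂, v, u, l, h1, h2, rfl, rfl⟩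
    · rfl
    · have := h2.supp (y := y) fun hne _ _ _ h => TD_supp M h y fun hm => hne (hy.2 hm)
      simp [ctxUnion, TD_supp N h1 y hy.1, this]
end

/-! #### Closed values -/

theorem Bang.append {P : Ctx → ℚ → ATy → Prop} {Γ Δ : Ctx} {w v : ℚ} {A B : ITy}
    (h : Bang P Γ w A) (h' : Bang P Δ v B) : Bang P (ctxUnion Γ Δ) (w + v) (A ++ B) := by
  induction h with
  | nil => simpa using h'
  | cons h0 h1 hP _ ih =>
    rw [ctxUnion_assoc, add_assoc]
    exact .cons h0 h1 hP ih

theorem Bang.scale {P : Ctx → ℚ → ATy → Prop} {Γ : Ctx} {w : ℚ} {A : ITy}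
    (h : Bang P Γ w A) {r : ℚ} (r0 : 0 < r) (r1 : r ≤ 1) :
    Bang P (scaleC r Γ) (r * w) (scaleL r A) := by
  induction h with
  | nil => simpa using Bang.nil
  | @cons Γ Δ u w q a A h0 h1 hP _ ih =>
    rw [scaleC_union, scaleC_mul, mul_add, ← mul_assoc]
    exact .cons (mul_pos r0 h0) (mul_le_one₀ r1 h0.le h1) hP ih

theorem closed_lam {V : Val} (hV : fvV V = ∅) : ∃ x M, V = .lam x M := by
  cases V with
  | var x => simp [fvV] at hV
  | lam x M => exact ⟨x, M, rfl⟩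

theorem VI_nil {V : Val} (hV : fvV V = ∅) : VI V emptyCtx 0 [] := by
  obtain ⟨x, M, rfl⟩ := closed_lam hV
  rw [VI]; exact .nil

theorem VI_append {V : Val} (hV : fvV V = ∅) {w v : ℚ} {A B : ITy}
    (h : VI V emptyCtx w A) (h' : VI V emptyCtx v B) : VI V emptyCtx (w + v) (A ++ B) := by
  obtain ⟨x, M, rfl⟩ := closed_lam hV
  rw [VI] at *
  simpa using h.append h'

theorem VI_scale {V : Val} (hV : fvV V = ∅) {w r : ℚ} {A : ITy}
    (h : VI V emptyCtx w A) (r0 : 0 < r) (r1 : r ≤ 1) :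
    VI V emptyCtx (r * w) (scaleL r A) := by
  obtain ⟨x, M, rfl⟩ := closed_lam hV
  rw [VI] at *
  simpa using h.scale r0 r1

/-! #### Anti-substitution -/

/-- `Q` is derivable after moving some resources on `x` from the closed value `V`. -/
def Anti (V : Val) (x : ℕ) (Q : Ctx → ℚ → Prop) (Γ : Ctx) (w : ℚ) : Prop :=
  ∃ A w₁ w₂, Γ x = [] ∧ Q (Function.update Γ x A) w₁ ∧ VI V emptyCtx w₂ A ∧ w = w₁ + w₂

theorem Anti.trivial {V : Val} (hV : fvV V = ∅) {x : ℕ} {Q : Ctx → ℚ → Prop} {Γ : Ctx} {w : ℚ}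
    (hx : Γ x = []) (h : Q Γ w) : Anti V x Q Γ w :=
  ⟨[], w, 0, hx, by rwa [update_nil hx], VI_nil hV, by simp⟩

theorem Bang.anti {V : Val} (hV : fvV V = ∅) {x : ℕ} {P P' : Ctx → ℚ → ATy → Prop} {Γ : Ctx}
    {w : ℚ} {A : ITy} (h : Bang P Γ w A)
    (hP : ∀ Γ w a, P Γ w a → Anti V x (fun Γ w => P' Γ w a) Γ w) :
    Anti V x (fun Γ w => Bang P' Γ w A) Γ w := by
  induction h with
  | nil => exact .trivial hV rfl .nil
  | @cons Γ Δ u w q a A h0 h1 h _ ih =>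
    obtain ⟨A₁, w₁, w₂, e1, t1, v1, rfl⟩ := hP _ _ _ h
    obtain ⟨A₂, w₃, w₄, e2, t2, v2, rfl⟩ := ih
    refine ⟨scaleL q A₁ ++ A₂, q * w₁ + w₃, q * w₂ + w₄, ?_, ?_,
      VI_append hV (VI_scale hV v1 h0 h1) v2, by ring⟩
    · simp [ctxUnion, scaleC, e1, e2]
    · rw [update_union, update_scale]
      exact .cons h0 h1 t1 t2

theorem LetK.anti {V : Val} (hV : fvV V = ∅) {x y : ℕ} (hxy : y ≠ x)
    {P P' : Ctx → ℚ → DTy → Prop} {Γ : Ctx}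
    {w : ℚ} {l b : DTy} (h : LetK y P Γ w l b)
    (hP : ∀ Γ w a, P Γ w a → Anti V x (fun Γ w => P' Γ w a) Γ w) :
    Anti V x (fun Γ w => LetK y P' Γ w l b) Γ w := by
  induction h with
  | nil => exact .trivial hV rfl .nil
  | @cons Γ Δ u w q A b c l h0 h1 hy h _ ih =>
    obtain ⟨A₁, w₁, w₂, e1, t1, v1, rfl⟩ := hP _ _ _ h
    obtain ⟨A₂, w₃, w₄, e2, t2, v2, rfl⟩ := ih
    rw [Function.update_of_ne hxy.symm] at e1
    refine ⟨scaleL q A₁ ++ A₂, q * w₁ + w₃, q * w₂ + w₄, ?_, ?_,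
      VI_append hV (VI_scale hV v1 h0 h1) v2, by ring⟩
    · simp [ctxUnion, scaleC, e1, e2]
    · rw [update_union, update_scale]
      refine .cons h0 h1 ?_ ?_ t2
      · rw [Function.update_of_ne hxy, hy]
      · rw [Function.update_comm hxy.symm]; exact t1

mutual
theorem VI_anti {V : Val} (hV : fvV V = ∅) (x : ℕ) : ∀ (W : Val) {Γ : Ctx} {w : ℚ} {A : ITy},
    VI (substV W x V) Γ w A → Anti V x (fun Γ w => VI W Γ w A) Γ w
  | .var y, Γ, w, A, h => by
    rw [substV] at h
    split_ifs at h with hy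
    · subst hy
      have : Γ = emptyCtx := by
        funext z; exact VI_supp V h z (by simp [hV])
      subst this
      refine ⟨A, 0, w, rfl, ?_, h, by simp⟩
      rw [VI]; exact ⟨rfl, rfl⟩
    · refine .trivial hV ?_ h
      rw [VI] at h
      rw [h.1, Function.update_of_ne (Ne.symm hy)]; rfl
  | .lam y M, Γ, w, A, h => by
    rw [substV] at h
    split_ifs at h with hy
    · subst hy
      exact .trivial hV (VI_supp _ h y (by simp [fvV])) h
    · rw [VI] at h
      simp only [VI]
      refine h.anti hV ?_
      rintro _ _ _ ⟨Γ', w', b, hT, rfl, rfl, rfl⟩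
      obtain ⟨A₁, w₁, w₂, e1, t1, v1, rfl⟩ := TD_anti hV x M hT
      refine ⟨A₁, w₁ + 1, w₂, ?_, ⟨_, _, _, t1, ?_, rfl, ?_⟩, v1, by ring⟩
      · rw [Function.update_of_ne (Ne.symm hy), e1]
      · rw [Function.update_comm hy]
      · rw [Function.update_of_ne hy]
theorem TD_anti {V : Val} (hV : fvV V = ∅) (x : ℕ) : ∀ (M : Tm) {Γ : Ctx} {w : ℚ} {b : DTy},
    TD (substT M x V) Γ w b → Anti V x (fun Γ w => TD M Γ w b) Γ w
  | .val W, Γ, w, b, h => by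
    rw [substT, TD] at h
    rcases h with ⟨rfl, rfl, rfl⟩ | ⟨A, rfl, h⟩
    · exact .trivial hV rfl (TD_zero _)
    · obtain ⟨A₁, w₁, w₂, e1, t1, v1, rfl⟩ := VI_anti hV x W h
      refine ⟨A₁, w₁, w₂, e1, ?_, v1, rfl⟩
      rw [TD]; exact Or.inr ⟨A, rfl, t1⟩
  | .app W U, Γ, w, b, h => by
    rw [substT, TD] at h
    rcases h with ⟨rfl, rfl, rfl⟩ | ⟨Γ₁, Γ₂, w₁, w₂, A, h1, h2, rfl, rfl⟩
    · exact .trivial hV rfl (TD_zero _)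
    · obtain ⟨A₁, w₁, w₂, e1, t1, v1, rfl⟩ := VI_anti hV x W h1
      obtain ⟨A₂, w₃, w₄, e2, t2, v2, rfl⟩ := VI_anti hV x U h2
      refine ⟨A₁ ++ A₂, w₁ + w₃, w₂ + w₄, by simp [ctxUnion, e1, e2], ?_,
        VI_append hV v1 v2, by ring⟩
      rw [TD, update_union]
      exact Or.inr ⟨_, _, _, _, _, t1, t2, rfl, rfl⟩
  | .choice M N, Γ, w, b, h => by
    rw [substT, TD] at h
    rcases h with ⟨rfl, rfl, rfl⟩ | ⟨Γ₁, Γ₂, w₁, w₂, b₁, b₂, h1, h2, rfl, rfl, rfl⟩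
    · exact .trivial hV rfl (TD_zero _)
    · obtain ⟨A₁, w₁, w₂, e1, t1, v1, rfl⟩ := TD_anti hV x M h1
      obtain ⟨A₂, w₃, w₄, e2, t2, v2, rfl⟩ := TD_anti hV x N h2
      refine ⟨scaleL (1/2) A₁ ++ scaleL (1/2) A₂, w₁ / 2 + w₃ / 2 + 1, 1/2 * w₂ + 1/2 * w₄,
        by simp [ctxUnion, scaleC, e1, e2], ?_,
        VI_append hV (VI_scale hV v1 (by norm_num) (by norm_num))
          (VI_scale hV v2 (by norm_num) (by norm_num)), by ring⟩
      rw [TD, update_union, update_scale, update_scale]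
      exact Or.inr ⟨_, _, _, _, _, _, t1, t2, rfl, rfl, rfl⟩
  | .letin y N M, Γ, w, b, h => by
    rw [substT, TD] at h
    rcases h with ⟨rfl, rfl, rfl⟩ | ⟨Γ₁, Γ₂, v, u, l, h1, h2, rfl, rfl⟩
    · exact .trivial hV rfl (TD_zero _)
    · obtain ⟨A₁, w₁, w₂, e1, t1, v1, rfl⟩ := TD_anti hV x N h1
      have key : Anti V x (fun Γ w => LetK y (TD M) Γ w l b) Γ₂ u := by
        split_ifs at h2 with hy
        · subst hy
          exact .trivial hV (h2.supp fun h => absurd rfl h) h2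
        · exact h2.anti hV hy fun _ _ _ h => TD_anti hV x M h
      obtain ⟨A₂, w₃, w₄, e2, t2, v2, rfl⟩ := key
      refine ⟨A₁ ++ A₂, w₃ + w₁ + 1, w₂ + w₄, by simp [ctxUnion, e1, e2], ?_,
        VI_append hV v1 v2, by ring⟩
      rw [TD, update_union]
      exact Or.inr ⟨_, _, _, _, _, t1, t2, rfl, rfl⟩
end

/-! #### Steps -/

/-- Deterministic steps. -/
inductive DStep : Tm → Tm → Prop
  | beta (x M V) : fvV V = ∅ → DStep (.app (.lam x M) V) (substT M x V)
  | letval (x V M) : fvV V = ∅ → DStep (.letin x (.val V) M) (substT M x V)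
  | letstep {N N'} (x M) : DStep N N' → DStep (.letin x N M) (.letin x N' M)

/-- Probabilistic steps. -/
inductive CStep : Tm → Tm → Tm → Prop
  | choice (M N) : CStep (.choice M N) M N
  | letstep {N N₁ N₂} (x M) : CStep N N₁ N₂ →
      CStep (.letin x N M) (.letin x N₁ M) (.letin x N₂ M)

theorem TD_let_inv {x : ℕ} {N M : Tm} {w : ℚ} {b : DTy} (h : TD (.letin x N M) emptyCtx w b) :
    ∃ l v u, TD N emptyCtx v l ∧ LetK x (TD M) emptyCtx u l b ∧ w ≤ u + v + 1 := by
  rw [TD] at h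
  rcases h with ⟨-, rfl, rfl⟩ | ⟨Γ₁, Γ₂, v, u, l, h1, h2, e, rfl⟩
  · exact ⟨[], 0, 0, TD_zero _, .nil, by norm_num⟩
  · obtain ⟨rfl, rfl⟩ := union_eq_empty e.symm
    exact ⟨l, v, u, h1, h2, le_rfl⟩

theorem TD_let {x : ℕ} {N M : Tm} {u v : ℚ} {l b : DTy} (h1 : TD N emptyCtx v l)
    (h2 : LetK x (TD M) emptyCtx u l b) : TD (.letin x N M) emptyCtx (u + v + 1) b := by
  rw [TD]
  exact Or.inr ⟨_, _, _, _, _, h1, h2, by simp, rfl⟩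

theorem LetK.append {x : ℕ} {P : Ctx → ℚ → DTy → Prop} {Γ Δ : Ctx} {w v : ℚ} {l m b c : DTy}
    (h : LetK x P Γ w l b) (h' : LetK x P Δ v m c) :
    LetK x P (ctxUnion Γ Δ) (w + v) (l ++ m) (b ++ c) := by
  induction h with
  | nil => simpa using h'
  | cons h0 h1 hx hP _ ih =>
    rw [ctxUnion_assoc, add_assoc, List.append_assoc]
    exact .cons h0 h1 hx hP ih

theorem LetK.scale {x : ℕ} {P : Ctx → ℚ → DTy → Prop} {Γ : Ctx} {w : ℚ} {l b : DTy}
    (h : LetK x P Γ w l b) {r : ℚ} (r0 : 0 < r) (r1 : r ≤ 1) :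
    LetK x P (scaleC r Γ) (r * w) (scaleL r l) (scaleL r b) := by
  induction h with
  | nil => simpa using LetK.nil
  | @cons Γ Δ u w q A b c l h0 h1 hx hP _ ih =>
    rw [scaleC_union, scaleC_mul, mul_add, ← mul_assoc, scaleL_append, scaleL_mul]
    exact .cons (mul_pos r0 h0) (mul_le_one₀ r1 h0.le h1) hx hP ih

theorem DStep.expand {M M' : Tm} (h : DStep M M') : ∀ {w : ℚ} {b : DTy},
    TD M' emptyCtx w b → ∃ w', w + 1 ≤ w' ∧ TD M emptyCtx w' b := by
  induction h with
  | beta x M V hV =>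
    intro w b h
    obtain ⟨A, w₁, w₂, -, t, v, rfl⟩ := TD_anti hV x M h
    refine ⟨w₁ + 1 + w₂, by linarith, ?_⟩
    rw [TD]
    refine Or.inr ⟨emptyCtx, emptyCtx, _, _, A, ?_, v, by simp, rfl⟩
    rw [VI]
    have := Bang.cons (q := 1) one_pos le_rfl
      (show LamP x (TD M) emptyCtx (w₁ + 1) (.arr A b) from
        ⟨_, _, _, t, by rw [Function.update_idem]; exact (update_nil rfl).symm, rfl, by simp⟩)
      Bang.nil
    simpa using this
  | letval x V M hV =>
    intro w b h
    obtain ⟨A, w₁, w₂, -, t, v, rfl⟩ := TD_anti hV x M h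
    refine ⟨w₁ + w₂ + 1, le_rfl, TD_let (l := [(1, A)]) ?_ ?_⟩
    · rw [TD]; exact Or.inr ⟨A, rfl, v⟩
    · have := LetK.cons (p := 1) (x := x) (P := TD M) one_pos le_rfl rfl t LetK.nil
      simpa [scaleL_one] using this
  | letstep x M _ ih =>
    intro w b h
    obtain ⟨l, v, u, h1, h2, hw⟩ := TD_let_inv h
    obtain ⟨v', hv, h1'⟩ := ih h1
    exact ⟨_, by linarith, TD_let h1' h2⟩

theorem CStep.expand {M M₁ M₂ : Tm} (h : CStep M M₁ M₂) : ∀ {w₁ w₂ : ℚ} {b₁ b₂ : DTy},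
    TD M₁ emptyCtx w₁ b₁ → TD M₂ emptyCtx w₂ b₂ →
    ∃ w', w₁ / 2 + w₂ / 2 + 1 ≤ w' ∧
      TD M emptyCtx w' (scaleL (1/2) b₁ ++ scaleL (1/2) b₂) := by
  induction h with
  | choice M N =>
    intro w₁ w₂ b₁ b₂ h1 h2
    refine ⟨_, le_rfl, ?_⟩
    rw [TD]
    exact Or.inr ⟨_, _, _, _, _, _, h1, h2, by simp, rfl, rfl⟩
  | letstep x M _ ih =>
    intro w₁ w₂ b₁ b₂ h1 h2
    obtain ⟨l₁, v₁, u₁, n1, k1, hw1⟩ := TD_let_inv h1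
    obtain ⟨l₂, v₂, u₂, n2, k2, hw2⟩ := TD_let_inv h2
    obtain ⟨v', hv, n⟩ := ih n1 n2
    have k := (k1.scale (r := 1/2) (by norm_num) (by norm_num)).append
      (k2.scale (r := 1/2) (by norm_num) (by norm_num))
    simp only [scaleC_empty, ctxUnion_empty] at k
    exact ⟨_, by linarith, TD_let n k⟩

/-! #### Closedness and progress -/

mutual
theorem fvV_subst {V : Val} (hV : fvV V = ∅) (x : ℕ) :
    ∀ W : Val, fvV (substV W x V) ⊆ fvV W \ {x}
  | .var y => by
    rw [substV]
    split_ifs with h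
    · simp [hV]
    · simp [fvV, h]
  | .lam y M => by
    rw [substV]
    split_ifs with h
    · simp [fvV, h]
    · have := fvT_subst hV x M
      intro z hz
      simp only [fvV, Finset.mem_sdiff, Finset.mem_singleton] at hz ⊢
      have := this hz.1
      simp only [Finset.mem_sdiff, Finset.mem_singleton] at this
      tauto
theorem fvT_subst {V : Val} (hV : fvV V = ∅) (x : ℕ) :
    ∀ M : Tm, fvT (substT M x V) ⊆ fvT M \ {x}
  | .val W => by
    simpa only [substT, fvT] using fvV_subst hV x W
  | .app W U => by
    intro z hz
    have h1 := @fvV_subst _ hV x W z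
    have h2 := @fvV_subst _ hV x U z
    simp only [substT, fvT, Finset.mem_sdiff, Finset.mem_singleton, Finset.mem_union] at *
    tauto
  | .choice M N => by
    intro z hz
    have h1 := @fvT_subst _ hV x M z
    have h2 := @fvT_subst _ hV x N z
    simp only [substT, fvT, Finset.mem_sdiff, Finset.mem_singleton, Finset.mem_union] at *
    tauto
  | .letin y N M => by
    intro z hz
    have h1 := @fvT_subst _ hV x N z
    have h2 := @fvT_subst _ hV x M z
    rw [substT] at hz
    split_ifs at hz with h
    · subst h
      simp only [fvT, Finset.mem_sdiff, Finset.mem_singleton, Finset.mem_union] at *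
      tauto
    · simp only [fvT, Finset.mem_sdiff, Finset.mem_singleton, Finset.mem_union] at *
      tauto
end

theorem closed_subst {V : Val} (hV : fvV V = ∅) {x : ℕ} {M : Tm} (h : fvT M \ {x} = ∅) :
    fvT (substT M x V) = ∅ := by
  have := fvT_subst hV x M
  rw [h] at this
  exact Finset.subset_empty.mp this

theorem DStep.closed {M M' : Tm} (h : DStep M M') : fvT M = ∅ → fvT M' = ∅ := by
  induction h with
  | beta x M V hV =>
    intro h
    simp only [fvT, fvV, Finset.union_eq_empty] at h
    exact closed_subst hV h.1
  | letval x V M hV =>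
    intro h
    simp only [fvT, Finset.union_eq_empty] at h
    exact closed_subst hV h.2
  | letstep x M _ ih =>
    intro h
    simp only [fvT, Finset.union_eq_empty] at h ⊢
    exact ⟨ih h.1, h.2⟩

theorem CStep.closed {M M₁ M₂ : Tm} (h : CStep M M₁ M₂) :
    fvT M = ∅ → fvT M₁ = ∅ ∧ fvT M₂ = ∅ := by
  induction h with
  | choice M N =>
    intro h
    simpa only [fvT, Finset.union_eq_empty] using h
  | letstep x M _ ih =>
    intro h
    simp only [fvT, Finset.union_eq_empty] at h ⊢
    exact ⟨⟨(ih h.1).1, h.2⟩, ⟨(ih h.1).2, h.2⟩⟩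

theorem progress : ∀ M : Tm, fvT M = ∅ →
    (∃ V, M = .val V) ∨ (∃ M', DStep M M') ∨ (∃ M₁ M₂, CStep M M₁ M₂)
  | .val V, _ => Or.inl ⟨V, rfl⟩
  | .app V W, h => by
    simp only [fvT, Finset.union_eq_empty] at h
    obtain ⟨x, M, rfl⟩ := closed_lam h.1
    exact Or.inr (Or.inl ⟨_, .beta x M W h.2⟩)
  | .choice M N, _ => Or.inr (Or.inr ⟨_, _, .choice M N⟩)
  | .letin x N M, h => by
    simp only [fvT, Finset.union_eq_empty] at h
    rcases progress N h.1 with ⟨V, rfl⟩ | ⟨N', h'⟩ | ⟨N₁, N₂, h'⟩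
    · exact Or.inr (Or.inl ⟨_, .letval x V M (by simpa only [fvT] using h.1)⟩)
    · exact Or.inr (Or.inl ⟨_, .letstep x M h'⟩)
    · exact Or.inr (Or.inr ⟨_, _, .letstep x M h'⟩)

theorem DStep.notVal {M M' : Tm} (h : DStep M M') : M.isVal = false := by
  cases h <;> rfl

theorem CStep.notVal {M M₁ M₂ : Tm} (h : CStep M M₁ M₂) : M.isVal = false := by
  cases h <;> rfl

theorem stepF_let {N : Tm} (x : ℕ) (M : Tm) (h : N.isVal = false) :
    stepF (.letin x N M) = (stepF N).map fun p => (p.1, Tm.letin x p.2 M) := by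
  cases N with
  | val V => simp [Tm.isVal] at h
  | app V W => rw [stepF]; simp
  | choice M N => conv_lhs => rw [stepF.eq_def]
  | letin x M N => rw [stepF]; simp

theorem DStep.stepF {M M' : Tm} (h : DStep M M') : stepF M = {(1, M')} := by
  induction h with
  | beta x M V hV => simp [CbV.stepF]
  | letval x V M hV => simp [CbV.stepF]
  | letstep x M h ih => rw [stepF_let x M h.notVal, ih]; simp

theorem CStep.stepF {M M₁ M₂ : Tm} (h : CStep M M₁ M₂) :
    stepF M = {(1/2, M₁), (1/2, M₂)} := by
  induction h with
  | choice M N => simp [CbV.stepF]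
  | letstep x M h ih => rw [stepF_let x M h.notVal, ih]; simp

/-! #### Trajectories -/

theorem scaleM_one (m : MDist) : scaleM 1 m = m := by simp [scaleM]

theorem scaleM_mul (q r : ℚ) (m : MDist) : scaleM q (scaleM r m) = scaleM (q * r) m := by
  simp [scaleM, mul_assoc]

theorem mstepF_add (m n : MDist) : mstepF (m + n) = mstepF m + mstepF n := by
  simp [mstepF]

theorem mstepF_scale (q : ℚ) (m : MDist) : mstepF (scaleM q m) = scaleM q (mstepF m) := by
  induction m using Multiset.induction_on with
  | empty => simp [mstepF, scaleM]
  | cons a m ih =>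
    have e : scaleM q (a ::ₘ m) = {(q * a.1, a.2)} + scaleM q m := by simp [scaleM]
    rw [e, mstepF_add, ih, ← Multiset.singleton_add a m, mstepF_add]
    have : ∀ m n : MDist, scaleM q (m + n) = scaleM q m + scaleM q n := by simp [scaleM]
    rw [this]
    congr 1
    simp [mstepF, scaleM_mul]

theorem mstepF_iter_add (k : ℕ) : ∀ (m n : MDist), mstepF^[k] (m + n) = mstepF^[k] m + mstepF^[k] n := by
  induction k with
  | zero => intro m n; rfl
  | succ k ih => intro m n; simp only [Function.iterate_succ, Function.comp, mstepF_add, ih]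

theorem mstepF_iter_scale (k : ℕ) (q : ℚ) :
    ∀ m : MDist, mstepF^[k] (scaleM q m) = scaleM q (mstepF^[k] m) := by
  induction k with
  | zero => intro m; rfl
  | succ k ih => intro m; simp only [Function.iterate_succ, Function.comp, mstepF_scale, ih]

theorem normV_add (m n : MDist) : normV (m + n) = normV m + normV n := by
  simp [normV]

theorem normV_scale (q : ℚ) (m : MDist) : normV (scaleM q m) = q * normV m := by
  simp only [normV, scaleM, Multiset.filter_map, Multiset.map_map, Function.comp_def,
    Multiset.sum_map_mul_left]

theorem evalP_zero {M : Tm} (h : M.isVal = false) : evalP 0 M = 0 := by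
  simp [evalP, traj, normV, Multiset.filter_singleton, h]

theorem evalP_val (V : Val) (k : ℕ) : evalP k (.val V) = 1 := by
  have : ∀ k, traj (.val V) k = {(1, .val V)} := by
    intro k
    apply Function.iterate_fixed
    simp [mstepF, stepF, scaleM]
  simp [evalP, this, normV, Multiset.filter_singleton, Tm.isVal]

theorem DStep.evalP {M M' : Tm} (h : DStep M M') (k : ℕ) : evalP (k + 1) M = evalP k M' := by
  have : mstepF {(1, M)} = {(1, M')} := by simp [mstepF, h.stepF, scaleM]
  simp only [CbV.evalP, traj, Function.iterate_succ, Function.comp, this]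

theorem CStep.evalP {M M₁ M₂ : Tm} (h : CStep M M₁ M₂) (k : ℕ) :
    evalP (k + 1) M = evalP k M₁ / 2 + evalP k M₂ / 2 := by
  have : mstepF {(1, M)} = scaleM (1/2) {(1, M₁)} + scaleM (1/2) {(1, M₂)} := by
    simp [mstepF, h.stepF, scaleM]
  simp only [CbV.evalP, traj, Function.iterate_succ, Function.comp, this, mstepF_iter_add,
    mstepF_iter_scale, normV_add, normV_scale]
  ring

theorem TD_etime (k : ℕ) : ∀ M : Tm, fvT M = ∅ → ∃ w, etime k M ≤ w ∧ TD M emptyCtx w [] := by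
  induction k with
  | zero => intro M _; exact ⟨0, by simp [etime], TD_zero M⟩
  | succ k ih =>
    intro M hM
    rcases progress M hM with ⟨V, rfl⟩ | ⟨M', h⟩ | ⟨M₁, M₂, h⟩
    · exact ⟨0, by simp [etime, evalP_val], TD_zero _⟩
    · obtain ⟨w, hw, t⟩ := ih M' (h.closed hM)
      obtain ⟨w', hw', t'⟩ := h.expand t
      refine ⟨w', ?_, t'⟩
      have : etime (k + 1) M = etime k M' + 1 := by
        simp only [etime, Finset.sum_range_succ', h.evalP, evalP_zero h.notVal, sub_zero]
      linarith
    · obtain ⟨w₁, hw₁, t₁⟩ := ih M₁ (h.closed hM).1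
      obtain ⟨w₂, hw₂, t₂⟩ := ih M₂ (h.closed hM).2
      obtain ⟨w', hw', t'⟩ := h.expand t₁ t₂
      refine ⟨w', ?_, by simpa using t'⟩
      have : etime (k + 1) M = etime k M₁ / 2 + etime k M₂ / 2 + 1 := by
        simp only [etime, Finset.sum_range_succ', h.evalP, evalP_zero h.notVal, sub_zero,
          Finset.sum_div, ← Finset.sum_add_distrib]
        congr 1
        exact Finset.sum_congr rfl fun i _ => by ring
      linarith

/-- **Finitary Completeness of Null Typing**: for every `k` there is a
derivation `Π ⊳ ⊢_w M : 𝟘` with `w ≥ etime_k(M)`. -/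
theorem finitary_completeness_null {M : Tm} (hM : M.Closed) (k : ℕ) :
    ∃ w : ℚ, Nonempty (Deriv emptyCtx w M (.dist [])) ∧ w ≥ etime k M := by
  obtain ⟨w, hw, t⟩ := TD_etime k M hM
  exact ⟨w, TD_sound M t, hw⟩

end CbV
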